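/- Let Λ be a finite set and let K_M ≥ K̄_M ≥ 0 be finitely supported families of constants indexed by M ∈ ℤ^Λ. Define the doubled Hamiltonian Ĥ(φ,φ̄) = −Σ_M K_M cos(M·φ) − Σ_M K̄_M cos(M·φ̄) on [0,2π]^Λ × [0,2π]^Λ. Then for every β > 0, every n ∈ ℕ, all N_1,…,N_n ∈ ℤ^Λ and all ε_1,…,ε_n ∈ {+1,−1}, the expectation ⟨ ∏_{s=1}^n ( cos(N_s·φ) + ε_s cos(N_s·φ̄) ) ⟩ with respect to the normalized measure Z⁻¹ e^{−βĤ(φ,φ̄)} ∏_x (dφ_x/(2π)) ∏_x (dφ̄_x/(2π)) is nonnegative. -/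

import Mathlib

open MeasureTheory Real

/-- The box `[0, 2π]^Λ` of classical XY configurations. -/
def xyBox (Λ : Type*) [Fintype Λ] : Set (Λ → ℝ) :=
  Set.univ.pi fun _ : Λ => Set.Icc (0 : ℝ) (2 * π)

/-- `M·φ = Σ_{x∈Λ} m_x φ_x` for `M ∈ ℤ^Λ` and `φ ∈ [0,2π]^Λ`. -/
noncomputable def zdot {Λ : Type*} [Fintype Λ] (M : Λ → ℤ) (φ : Λ → ℝ) : ℝ :=
  ∑ x : Λ, (M x : ℝ) * φ x

/-- Doubled Hamiltonian `Ĥ(φ,φ̄) = −Σ_M K_M cos(M·φ) − Σ_M K̄_M cos(M·φ̄)`. -/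
noncomputable def doubledHam {Λ : Type*} [Fintype Λ] (K Kb : (Λ → ℤ) → ℝ)
    (φ ψ : Λ → ℝ) : ℝ :=
  (-∑ᶠ M : Λ → ℤ, K M * Real.cos (zdot M φ)) - ∑ᶠ M : Λ → ℤ, Kb M * Real.cos (zdot M ψ)

/-- Gibbs expectation for the doubled system at inverse temperature `β` (the normalisations
`1/(2π)` cancel in the ratio). -/
noncomputable def doubledGibbs {Λ : Type*} [Fintype Λ] (K Kb : (Λ → ℤ) → ℝ) (β : ℝ)
    (f : (Λ → ℝ) → (Λ → ℝ) → ℝ) : ℝ :=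
  (∫ φ in xyBox Λ, ∫ ψ in xyBox Λ, f φ ψ * Real.exp (-β * doubledHam K Kb φ ψ)) /
  (∫ φ in xyBox Λ, ∫ ψ in xyBox Λ, Real.exp (-β * doubledHam K Kb φ ψ))

section KernelCone

variable {X : Type*} [TopologicalSpace X] [CompactSpace X]

/-- The multiplicative submonoid of kernels `(u, v) ↦ F u * F v`. -/
def squareKernels (X : Type*) [TopologicalSpace X] : Submonoid C(X × X, ℝ) where
  carrier := Set.range fun F : C(X, ℝ) => F.comp ContinuousMap.fst * F.comp ContinuousMap.snd
  one_mem' := ⟨1, by ext; simp⟩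
  mul_mem' := by
    rintro _ _ ⟨F, rfl⟩ ⟨G, rfl⟩
    exact ⟨F * G, by ext; simp; ring⟩

/-- The closed convex cone of kernels generated by the kernels `(u, v) ↦ F u * F v`. -/
noncomputable def kernelCone (X : Type*) [TopologicalSpace X] [CompactSpace X] : Subsemiring C(X × X, ℝ) :=
  (squareKernels X).subsemiringClosure.topologicalClosure

theorem mem_kernelCone_of_eq_mul {k : C(X × X, ℝ)} (F : C(X, ℝ))
    (h : ∀ u v, k (u, v) = F u * F v) : k ∈ kernelCone X :=
  Subsemiring.le_topologicalClosure _ <| AddSubmonoid.subset_closure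
    ⟨F, by ext ⟨u, v⟩; simp [h]⟩

theorem smul_mem_kernelCone {c : ℝ} (hc : 0 ≤ c) {k : C(X × X, ℝ)} (hk : k ∈ kernelCone X) :
    c • k ∈ kernelCone X := by
  have hconst : ContinuousMap.const (X × X) c ∈ kernelCone X :=
    mem_kernelCone_of_eq_mul (ContinuousMap.const X (√c)) fun u v => by
      simp [Real.mul_self_sqrt hc]
  have heq : c • k = ContinuousMap.const (X × X) c * k := by ext; simp
  rw [heq]
  exact mul_mem hconst hk

theorem exp_mem_kernelCone {k : C(X × X, ℝ)} (hk : k ∈ kernelCone X) :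
    NormedSpace.exp k ∈ kernelCone X := by
  have hclosed : IsClosed (kernelCone X : Set C(X × X, ℝ)) :=
    Subsemiring.isClosed_topologicalClosure _
  refine hclosed.mem_of_tendsto (NormedSpace.exp_series_hasSum_exp' (𝕂 := ℝ) k)
    (Filter.Eventually.of_forall fun s => ?_)
  exact sum_mem fun n _ => smul_mem_kernelCone (by positivity) (pow_mem hk n)

theorem ContinuousMap.exp_apply {Y : Type*} [TopologicalSpace Y] [CompactSpace Y]
    (k : C(Y, ℝ)) (y : Y) : NormedSpace.exp k y = Real.exp (k y) := by
  rw [Real.exp_eq_exp_ℝ]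
  exact NormedSpace.map_exp (ContinuousMap.evalAlgHom ℝ ℝ y) (continuous_eval_const y) k

theorem ContinuousMap.continuous_integral {Y : Type*} [TopologicalSpace Y] [CompactSpace Y]
    [MeasurableSpace Y] [BorelSpace Y] [SecondCountableTopologyEither Y ℝ]
    (μ : Measure Y) [IsFiniteMeasure μ] : Continuous fun k : C(Y, ℝ) => ∫ y, k y ∂μ := by
  refine (MeasureTheory.continuous_integral.comp
    (ContinuousMap.toLp 1 μ ℝ (E := ℝ)).continuous).congr fun k => ?_
  exact integral_congr_ae (ContinuousMap.coeFn_toLp μ k)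

theorem integral_nonneg_of_mem_kernelCone [MeasurableSpace X] [BorelSpace X]
    [SecondCountableTopology X] (μ : Measure X) [IsFiniteMeasure μ] {k : C(X × X, ℝ)}
    (hk : k ∈ kernelCone X) : 0 ≤ ∫ p, k p ∂μ.prod μ := by
  have hclosed : IsClosed {k : C(X × X, ℝ) | 0 ≤ ∫ p, k p ∂μ.prod μ} :=
    isClosed_le continuous_const (ContinuousMap.continuous_integral _)
  refine closure_minimal (fun k hk => ?_) hclosed hk
  have hint (f : C(X × X, ℝ)) : Integrable f (μ.prod μ) :=
    f.continuous.integrable_of_hasCompactSupport (HasCompactSupport.of_compactSpace f)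
  induction hk using AddSubmonoid.closure_induction with
  | mem _ h =>
    obtain ⟨F, rfl⟩ := h
    have := integral_prod_mul (μ := μ) (ν := μ) F F
    simp only [Set.mem_ofPred_eq, ContinuousMap.mul_apply, ContinuousMap.comp_apply,
      ContinuousMap.fst_apply, ContinuousMap.snd_apply, this]
    exact mul_self_nonneg _
  | zero => simp
  | add f g _ _ hf hg =>
    simp only [Set.mem_ofPred_eq, ContinuousMap.add_apply] at hf hg ⊢
    rw [integral_add (hint f) (hint g)]
    exact add_nonneg hf hg

end KernelCone

section Torus

instance two_pi_pos_fact : Fact (0 < 2 * π) := ⟨Real.two_pi_pos⟩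

variable {Λ : Type*} [Fintype Λ]

theorem measurePreserving_box_torus :
    MeasurePreserving (fun (φ : Λ → ℝ) x => (φ x : AddCircle (2 * π)))
      (volume.restrict (xyBox Λ)) volume := by
  rw [xyBox, volume_pi, Measure.restrict_pi_pi]
  refine measurePreserving_pi _ _ fun _ => ?_
  have h := AddCircle.measurePreserving_mk (2 * π) 0
  rwa [zero_add, restrict_Ioc_eq_restrict_Icc] at h

/-- The homomorphism `(u, v) ↦ (u - v, u + v)`. -/
def subAddHom (G : Type*) [AddCommGroup G] : G × G →+ G × G :=
  (AddMonoidHom.fst G G - AddMonoidHom.snd G G).prod (AddMonoidHom.fst G G + AddMonoidHom.snd G G)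

@[simp] theorem subAddHom_apply {G : Type*} [AddCommGroup G] (p : G × G) :
    subAddHom G p = (p.1 - p.2, p.1 + p.2) := rfl

theorem subAddHom_surjective {G : Type*} [AddCommGroup G] (h : ∀ a : G, ∃ b, b + b = a) :
    Function.Surjective (subAddHom G) := by
  rintro ⟨a, b⟩
  obtain ⟨v, hv⟩ := h (b - a)
  refine ⟨(a + v, v), ?_⟩
  simp [add_assoc, hv]

theorem measurePreserving_subAddHom {G : Type*} [AddCommGroup G] [TopologicalSpace G]
    [IsTopologicalAddGroup G] [CompactSpace G] [SecondCountableTopology G] [MeasurableSpace G]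
    [BorelSpace G] (μ : Measure G) [IsFiniteMeasure μ] [μ.IsAddHaarMeasure]
    (h : ∀ a : G, ∃ b, b + b = a) :
    MeasurePreserving (subAddHom G) (μ.prod μ) (μ.prod μ) :=
  (subAddHom G).measurePreserving
    ((continuous_fst.sub continuous_snd).prodMk (continuous_fst.add continuous_snd))
    (subAddHom_surjective h) rfl

theorem measurePreserving_subAddHom_torus :
    MeasurePreserving (subAddHom (Λ → AddCircle (2 * π))) (volume.prod volume)
      (volume.prod volume) := by
  refine measurePreserving_subAddHom _ fun a => ?_
  choose r hr using fun x => QuotientAddGroup.mk_surjective (a x)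
  refine ⟨fun x => ((r x / 2 : ℝ) : AddCircle (2 * π)), funext fun x => ?_⟩
  rw [← hr x, Pi.add_apply, ← AddCircle.coe_add, add_halves]

/-- The character `θ ↦ exp (i M·θ)` of the torus. -/
noncomputable def torusChar (M : Λ → ℤ) (θ : Λ → AddCircle (2 * π)) : Circle :=
  AddCircle.toCircle (∑ x, M x • θ x)

/-- The function `cos (M·θ)` on the torus. -/
noncomputable def torusCos (M : Λ → ℤ) : C(Λ → AddCircle (2 * π), ℝ) where
  toFun θ := (torusChar M θ : ℂ).re
  continuous_toFun := by
    refine Complex.continuous_re.comp (continuous_subtype_val.comp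
      (AddCircle.continuous_toCircle.comp ?_))
    fun_prop

/-- The function `sin (M·θ)` on the torus. -/
noncomputable def torusSin (M : Λ → ℤ) : C(Λ → AddCircle (2 * π), ℝ) where
  toFun θ := (torusChar M θ : ℂ).im
  continuous_toFun := by
    refine Complex.continuous_im.comp (continuous_subtype_val.comp
      (AddCircle.continuous_toCircle.comp ?_))
    fun_prop

theorem torusChar_add (M : Λ → ℤ) (u v : Λ → AddCircle (2 * π)) :
    torusChar M (u + v) = torusChar M u * torusChar M v := by
  simp [torusChar, Finset.sum_add_distrib, AddCircle.toCircle_add]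

theorem torusChar_neg (M : Λ → ℤ) (u : Λ → AddCircle (2 * π)) :
    torusChar M (-u) = (torusChar M u)⁻¹ := by
  simp [torusChar, AddCircle.toCircle_neg]

theorem torusCos_add (M : Λ → ℤ) (u v : Λ → AddCircle (2 * π)) :
    torusCos M (u + v) = torusCos M u * torusCos M v - torusSin M u * torusSin M v := by
  simp [torusCos, torusSin, torusChar_add]

theorem torusCos_sub (M : Λ → ℤ) (u v : Λ → AddCircle (2 * π)) :
    torusCos M (u - v) = torusCos M u * torusCos M v + torusSin M u * torusSin M v := by
  simp [torusCos, torusSin, torusChar_add, torusChar_neg, sub_eq_add_neg]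

theorem torusCos_coe (M : Λ → ℤ) (φ : Λ → ℝ) :
    torusCos M (fun x => (φ x : AddCircle (2 * π))) = Real.cos (zdot M φ) := by
  have h : ∑ x, M x • ((φ x : ℝ) : AddCircle (2 * π)) = ((zdot M φ : ℝ) : AddCircle (2 * π)) := by
    simp only [zdot, ← zsmul_eq_mul, ← AddCircle.coe_zsmul]
    exact (map_sum (QuotientAddGroup.mk' (AddSubgroup.zmultiples (2 * π))) _ _).symm
  simp [torusCos, torusChar, h, AddCircle.toCircle_apply_mk, Complex.exp_ofReal_mul_I_re]

/-- The kernel `cos (M·φ) + ε cos (M·ψ)` at `φ = u - v`, `ψ = u + v`. -/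
noncomputable def cosPairKernel (M : Λ → ℤ) (ε : ℝ) :
    C((Λ → AddCircle (2 * π)) × (Λ → AddCircle (2 * π)), ℝ) where
  toFun p := torusCos M (p.1 - p.2) + ε * torusCos M (p.1 + p.2)

theorem cosPairKernel_mem_kernelCone (M : Λ → ℤ) {ε : ℝ} (hε : ε = 1 ∨ ε = -1) :
    cosPairKernel M ε ∈ kernelCone (Λ → AddCircle (2 * π)) := by
  have h2 : √2 * √2 = 2 := Real.mul_self_sqrt zero_le_two
  rcases hε with rfl | rfl
  · refine mem_kernelCone_of_eq_mul (√2 • torusCos M) fun u v => ?_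
    simp only [cosPairKernel, ContinuousMap.coe_mk, torusCos_sub, torusCos_add,
      ContinuousMap.smul_apply, smul_eq_mul]
    linear_combination (-torusCos M u * torusCos M v) * h2
  · refine mem_kernelCone_of_eq_mul (√2 • torusSin M) fun u v => ?_
    simp only [cosPairKernel, ContinuousMap.coe_mk, torusCos_sub, torusCos_add,
      ContinuousMap.smul_apply, smul_eq_mul]
    linear_combination (-torusSin M u * torusSin M v) * h2

theorem setIntegral_box_box_eq_torus
    (f : C((Λ → AddCircle (2 * π)) × (Λ → AddCircle (2 * π)), ℝ)) :
    ∫ φ in xyBox Λ, ∫ ψ in xyBox Λ, f (fun x => (φ x : AddCircle (2 * π)),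
      fun x => (ψ x : AddCircle (2 * π))) = ∫ p, f p ∂(volume.prod volume) := by
  have hmp := measurePreserving_box_torus (Λ := Λ)
  rw [integral_prod _ (f.continuous.integrable_of_hasCompactSupport
    (HasCompactSupport.of_compactSpace f))]
  have hcomp {g : (Λ → AddCircle (2 * π)) → ℝ} (hg : Continuous g) :
      ∫ φ in xyBox Λ, g (fun x => (φ x : AddCircle (2 * π))) = ∫ θ, g θ := by
    rw [← hmp.map_eq]
    exact (integral_map hmp.aemeasurable hg.aestronglyMeasurable).symm
  have hinner (θ : Λ → AddCircle (2 * π)) :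
      ∫ ψ in xyBox Λ, f (θ, fun x => (ψ x : AddCircle (2 * π))) = ∫ η, f (θ, η) :=
    hcomp (g := fun η => f (θ, η)) (by fun_prop)
  simp only [hinner]
  refine hcomp (g := fun θ => ∫ η, f (θ, η)) ?_
  have h := continuous_parametric_integral_of_continuous
    (μ := (volume : Measure (Λ → AddCircle (2 * π)))) (f := fun θ η => f (θ, η))
    (by exact f.continuous) (s := Set.univ) isCompact_univ
  simpa using h

/-- The doubled integral is nonnegative when its pullback to `(u, v)` lies in the kernel cone. -/
theorem integral_torus_nonneg
    (f : C((Λ → AddCircle (2 * π)) × (Λ → AddCircle (2 * π)), ℝ))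
    {k : C((Λ → AddCircle (2 * π)) × (Λ → AddCircle (2 * π)), ℝ)}
    (hk : k ∈ kernelCone (Λ → AddCircle (2 * π))) (hf : ∀ u v, f (u - v, u + v) = k (u, v)) :
    0 ≤ ∫ p, f p ∂(volume.prod volume) := by
  have hmp := measurePreserving_subAddHom_torus (Λ := Λ)
  have heq : ∫ p, f p ∂(volume.prod volume) = ∫ p, k p ∂(volume.prod volume) := by
    conv_lhs => rw [← hmp.map_eq]
    rw [integral_map hmp.aemeasurable f.continuous.aestronglyMeasurable]
    exact integral_congr_ae (Filter.Eventually.of_forall fun p => hf p.1 p.2)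
  rw [heq]
  exact integral_nonneg_of_mem_kernelCone _ hk

end Torus

theorem neg_mul_doubledHam_eq_sum {Λ : Type*} [Fintype Λ] (K Kb : (Λ → ℤ) → ℝ)
    (s : Finset (Λ → ℤ)) (hK : Function.support K ⊆ s) (hKb : Function.support Kb ⊆ s)
    (β : ℝ) (φ ψ : Λ → ℝ) :
    -β * doubledHam K Kb φ ψ = ∑ M ∈ s,
      (β * (K M + Kb M) / 2 * (Real.cos (zdot M φ) + 1 * Real.cos (zdot M ψ)) +
        β * (K M - Kb M) / 2 * (Real.cos (zdot M φ) + -1 * Real.cos (zdot M ψ))) := by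
  rw [doubledHam, finsum_eq_sum_of_support_subset _
      ((Function.support_mul_subset_left K _).trans hK),
    finsum_eq_sum_of_support_subset _ ((Function.support_mul_subset_left Kb _).trans hKb),
    ← Finset.sum_neg_distrib, ← Finset.sum_sub_distrib, Finset.mul_sum]
  exact Finset.sum_congr rfl fun M _ => by ring

/-- For the doubled system with `K_M ≥ K̄_M ≥ 0`, the Gibbs expectation of any product
`∏_s (cos(N_s·φ) + ε_s cos(N_s·φ̄))` with signs `ε_s = ±1` is nonnegative. -/
theorem doubled_gibbs_prod_cos_pm_nonneg {Λ : Type*} [Fintype Λ]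
    (K Kb : (Λ → ℤ) → ℝ)
    (hK_fin : (Function.support K).Finite) (hKb_fin : (Function.support Kb).Finite)
    (hKb_nonneg : ∀ M : Λ → ℤ, 0 ≤ Kb M) (hle : ∀ M : Λ → ℤ, Kb M ≤ K M)
    (β : ℝ) (hβ : 0 < β) (n : ℕ)
    (N : Fin n → Λ → ℤ) (ε : Fin n → ℝ) (hε : ∀ s : Fin n, ε s = 1 ∨ ε s = -1) :
    0 ≤ doubledGibbs K Kb β
        (fun φ ψ => ∏ s : Fin n, (Real.cos (zdot (N s) φ) + ε s * Real.cos (zdot (N s) ψ))) := by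
  refine div_nonneg ?_ (integral_nonneg fun φ => integral_nonneg fun ψ => (Real.exp_pos _).le)
  set s := (hK_fin.union hKb_fin).toFinset with hs
  have hKs : Function.support K ⊆ s := by simp [hs]
  have hKbs : Function.support Kb ⊆ s := by simp [hs]
  let E : C((Λ → AddCircle (2 * π)) × (Λ → AddCircle (2 * π)), ℝ) :=
    ∑ M ∈ s, ((β * (K M + Kb M) / 2) • cosPairKernel M 1 +
      (β * (K M - Kb M) / 2) • cosPairKernel M (-1))
  have hE : E ∈ kernelCone (Λ → AddCircle (2 * π)) := by
    refine sum_mem fun M _ => add_mem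
      (smul_mem_kernelCone ?_ (cosPairKernel_mem_kernelCone M (.inl rfl)))
      (smul_mem_kernelCone ?_ (cosPairKernel_mem_kernelCone M (.inr rfl)))
    · have := hKb_nonneg M
      have := (hKb_nonneg M).trans (hle M)
      positivity
    · have := sub_nonneg.2 (hle M)
      positivity
  let k := (∏ i, cosPairKernel (N i) (ε i)) * NormedSpace.exp E
  have hk : k ∈ kernelCone (Λ → AddCircle (2 * π)) :=
    mul_mem (prod_mem fun i _ => cosPairKernel_mem_kernelCone (N i) (hε i)) (exp_mem_kernelCone hE)
  let f : C((Λ → AddCircle (2 * π)) × (Λ → AddCircle (2 * π)), ℝ) :=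
    { toFun := fun p => (∏ i, (torusCos (N i) p.1 + ε i * torusCos (N i) p.2)) *
        Real.exp (∑ M ∈ s, (β * (K M + Kb M) / 2 * (torusCos M p.1 + 1 * torusCos M p.2) +
          β * (K M - Kb M) / 2 * (torusCos M p.1 + -1 * torusCos M p.2))) }
  have hfk : ∀ u v, f (u - v, u + v) = k (u, v) := fun u v => by
    simp [f, k, E, cosPairKernel, ContinuousMap.exp_apply, ContinuousMap.prod_apply,
      ContinuousMap.sum_apply]
  have h := integral_torus_nonneg f hk hfk
  rw [← setIntegral_box_box_eq_torus] at h
  simpa only [f, ContinuousMap.coe_mk, torusCos_coe,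
    ← neg_mul_doubledHam_eq_sum K Kb s hKs hKbs] using h
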